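/- If r ∈ {3,…,n-1}, then |Λ_n(r)| / |Ω_n| = 2(r-3)/(n-1) − 2(r-2)(r-3)/((n-1)(n-2)), where the quotients are taken in ℚ (or ℝ) and |Ω_n| = n!. -/

import Mathlib

open Finset

namespace Secretary

/-- Relative rank of `x` with regard to `P`: the number of `z ∈ P` with `z ≤ x`
(as an integer, so that differences can be computed in `ℤ`). -/
def rr {n : ℕ} (P : Finset (Fin n)) (x : Fin n) : ℤ :=
  ((P.filter fun z => z ≤ x).card : ℤ)

/-- `Δ(k) = {-1, 1, k-1, 1-k} ⊆ ℤ`. -/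
def Δ (k : ℕ) : Finset ℤ := {-1, 1, (k : ℤ) - 1, 1 - (k : ℤ)}

/-- `{x, y} ∈ Adj(P)`: both belong to `P` and the difference of their relative
ranks with regard to `P` (in one of the two orders) lies in `Δ(|P|)`. -/
def Adj {n : ℕ} (P : Finset (Fin n)) (x y : Fin n) : Prop :=
  x ∈ P ∧ y ∈ P ∧ (rr P x - rr P y ∈ Δ P.card ∨ rr P y - rr P x ∈ Δ P.card)

instance {n : ℕ} (P : Finset (Fin n)) (x y : Fin n) : Decidable (Adj P x y) := by
  unfold Adj; infer_instance

/-- `Ω n`: the sequences of `n` distinct applicants (as injective, hence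
bijective, functions `Fin n → Fin n`); `|Ω n| = n!`. -/
def Ω (n : ℕ) : Finset (Fin n → Fin n) :=
  Finset.univ.filter Function.Injective

/-- The `i`-th applicant of the sequence `x`, with the 1-based indexing
`x_1, …, x_n` of the paper. -/
def get {n : ℕ} [NeZero n] (x : Fin n → Fin n) (i : ℕ) : Fin n :=
  x ⟨(i - 1) % n, Nat.mod_lt _ (Nat.pos_of_ne_zero (NeZero.ne n))⟩

/-- The set `{x_1, …, x_i}` of the first `i` applicants of the sequence `x`. -/
def pre {n : ℕ} (x : Fin n → Fin n) (i : ℕ) : Finset (Fin n) :=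
  (Finset.univ.filter fun j : Fin n => (j : ℕ) < i).image x

/-- `Λ_n(r,k)`: sequences `x ∈ Ω_n` with `{x_k, x_{k+1}} ∈ Adj(C_n)` and
`{x_{i-1}, x_i} ∉ Adj({x_1,…,x_i})` for all `i ∈ {r,…,k}`. -/
def Lam : (n : ℕ) → ℕ → ℕ → Finset (Fin n → Fin n)
  | 0, _, _ => ∅
  | (m + 1), r, k =>
      (Ω (m + 1)).filter fun x =>
        Adj Finset.univ (get x k) (get x (k + 1)) ∧
          ∀ i, i ≤ k → r ≤ i → ¬ Adj (pre x i) (get x (i - 1)) (get x i)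

/-- `Λ_n(r) = ⋃_{k=r}^{n-1} Λ_n(r,k)`. -/
def LamU (n : ℕ) (r : ℕ) : Finset (Fin n → Fin n) :=
  (Finset.Icc r (n - 1)).biUnion fun k => Lam n r k

/-- `Π_n(r)`: those `x ∈ Λ_n(r)` such that for the (unique) `k` with
`x ∈ Λ_n(r,k)` one has `rr_n(x_k) - rr_n(x_{k+1}) ∈ {1-n, n-1}`. -/
def Pi' : (n : ℕ) → ℕ → Finset (Fin n → Fin n)
  | 0, _ => ∅
  | (m + 1), r =>
      (LamU (m + 1) r).filter fun x =>
        ∃ k ∈ Finset.Icc r m, x ∈ Lam (m + 1) r k ∧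
          rr Finset.univ (get x k) - rr Finset.univ (get x (k + 1)) ∈
            ({1 - ((m : ℤ) + 1), ((m : ℤ) + 1) - 1} : Finset ℤ)

/-- `Λ_n(r,k,z,z̄)`: sequences of `Λ_n(r,k)` with `x_k = z` and `x_{k+1} = z̄`. -/
def Lam4 : (n : ℕ) → ℕ → ℕ → Fin n → Fin n → Finset (Fin n → Fin n)
  | 0, _, _, z, _ => z.elim0
  | (m + 1), r, k, z, w =>
      (Lam (m + 1) r k).filter fun x => get x k = z ∧ get x (k + 1) = w

lemma mem_Δ {k : ℕ} {d : ℤ} : d ∈ Δ k ↔ d = -1 ∨ d = 1 ∨ d = k - 1 ∨ d = 1 - k := by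
  simp [Δ]

lemma rr_lt_rr {n : ℕ} {P : Finset (Fin n)} {x y : Fin n} (hy : y ∈ P) (h : x < y) :
    rr P x < rr P y := by
  unfold rr
  norm_cast
  apply card_lt_card
  rw [ssubset_iff_of_subset
    (monotone_filter_right P fun z _ (hz : z ≤ x) => hz.trans h.le)]
  exact ⟨y, by simp [hy], by simp [h]⟩

lemma rr_injOn {n : ℕ} (P : Finset (Fin n)) : Set.InjOn (rr P) P := by
  intro x hx y hy h
  rcases lt_trichotomy x y with hlt | heq | hlt
  · exact absurd h (rr_lt_rr hy hlt).ne
  · exact heq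
  · exact absurd h (rr_lt_rr hx hlt).ne'

lemma rr_mem_Icc {n : ℕ} {P : Finset (Fin n)} {x : Fin n} (hx : x ∈ P) :
    rr P x ∈ Icc (1 : ℤ) #P := by
  have h1 : 0 < #(P.filter fun z => z ≤ x) := card_pos.mpr ⟨x, by simp [hx]⟩
  have h2 : #(P.filter fun z => z ≤ x) ≤ #P := card_filter_le _ _
  simp only [rr, mem_Icc]
  omega

lemma image_rr {n : ℕ} (P : Finset (Fin n)) : P.image (rr P) = Icc (1 : ℤ) #P := by
  apply eq_of_subset_of_card_le
  · simpa only [image_subset_iff] using fun x hx => rr_mem_Icc hx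
  · rw [card_image_of_injOn (rr_injOn P)]
    simp

/-- Every rank in a cycle of at least three ranks has exactly two neighbours. -/
lemma card_rank_neighbours {m : ℕ} (hm : 3 ≤ m) {t : ℤ} (ht : t ∈ Icc (1 : ℤ) m) :
    #((Icc (1 : ℤ) m).filter fun s => s - t ∈ Δ m ∨ t - s ∈ Δ m) = 2 := by
  rw [mem_Icc] at ht
  have h : ((Icc (1 : ℤ) m).filter fun s => s - t ∈ Δ m ∨ t - s ∈ Δ m) =
      {if t = m then 1 else t + 1, if t = 1 then (m : ℤ) else t - 1} := by
    ext s
    simp only [mem_filter, mem_Icc, mem_Δ, mem_insert, mem_singleton]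
    split_ifs <;> omega
  rw [h, card_pair]
  split_ifs <;> omega

lemma card_adj {n : ℕ} {P : Finset (Fin n)} (hP : 3 ≤ #P) {y : Fin n} (hy : y ∈ P) :
    #(P.filter fun x => Adj P x y) = 2 := by
  rw [← card_rank_neighbours hP (rr_mem_Icc hy), ← image_rr, filter_image,
    card_image_of_injOn ((rr_injOn P).mono (coe_subset.mpr (filter_subset _ _)))]
  congr 1
  ext x
  simp +contextual [Adj, hy]

lemma not_adj_self {n : ℕ} {P : Finset (Fin n)} (hP : 3 ≤ #P) (y : Fin n) : ¬ Adj P y y := by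
  simp only [Adj, mem_Δ]
  omega

lemma card_erase_adj {n : ℕ} {P : Finset (Fin n)} (hP : 3 ≤ #P) {y : Fin n} (hy : y ∈ P) :
    #((P.erase y).filter fun x => Adj P x y) = 2 := by
  rw [filter_erase, erase_eq_of_notMem (by simp [not_adj_self hP]), card_adj hP hy]

lemma card_erase_not_adj {n : ℕ} {P : Finset (Fin n)} (hP : 3 ≤ #P) {y : Fin n} (hy : y ∈ P) :
    #((P.erase y).filter fun x => ¬ Adj P x y) = #P - 3 := by
  have h := card_filter_add_card_filter_not (s := P.erase y) fun x => Adj P x y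
  rw [card_erase_adj hP hy, card_erase_of_mem hy] at h
  omega

/-- If a set of functions and a property of values are invariant under swapping `p` with the
positions in `J`, then each position in `J` is as likely as `p` to hold a value with
the property. -/
lemma card_filter_mul_card_of_swap {α β : Type*} [DecidableEq α]
    {S : Finset (α → β)} {p : α} {J : Finset α} {R : (α → β) → β → Prop}
    [∀ x v, Decidable (R x v)] {c : ℕ}
    (hS : ∀ x ∈ S, ∀ a ∈ J, x ∘ Equiv.swap p a ∈ S)
    (hR : ∀ x ∈ S, ∀ a ∈ J, ∀ v, R (x ∘ Equiv.swap p a) v ↔ R x v)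
    (hc : ∀ x ∈ S, #(J.filter fun a => R x (x a)) = c) :
    #(S.filter fun x => R x (x p)) * #J = #S * c := by
  have hcount := sum_card_bipartiteAbove_eq_sum_card_bipartiteBelow (s := S) (t := J)
    fun x a => R x (x a)
  have hpos : ∀ a ∈ J, #(S.filter fun x => R x (x a)) = #(S.filter fun x => R x (x p)) := by
    intro a ha
    refine card_nbij' (fun x => x ∘ Equiv.swap p a) (fun x => x ∘ Equiv.swap p a)
      ?_ ?_ ?_ ?_
    · intro x hx
      simp only [coe_filter, Set.mem_ofPred_eq] at hx ⊢
      exact ⟨hS x hx.1 a ha, by simpa [hR x hx.1 a ha] using hx.2⟩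
    · intro x hx
      simp only [coe_filter, Set.mem_ofPred_eq] at hx ⊢
      exact ⟨hS x hx.1 a ha, by simpa [hR x hx.1 a ha] using hx.2⟩
    · intro x _
      ext i
      simp
    · intro x _
      ext i
      simp
  simp only [bipartiteAbove, bipartiteBelow] at hcount
  rw [sum_congr rfl hc, sum_congr rfl hpos] at hcount
  simpa [mul_comm] using hcount.symm

lemma comp_swap_mem_Ω {n : ℕ} {x : Fin n → Fin n} (hx : x ∈ Ω n) (p a : Fin n) :
    x ∘ Equiv.swap p a ∈ Ω n := by
  simp only [Ω, mem_filter, mem_univ, true_and] at hx ⊢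
  exact hx.comp (Equiv.injective _)

lemma card_Ω (n : ℕ) : #(Ω n) = n.factorial := by
  have h := Fintype.card_embedding_eq (α := Fin n) (β := Fin n)
  rw [Fintype.card_congr (Equiv.subtypeInjectiveEquivEmbedding _ _).symm,
    Fintype.card_subtype] at h
  simpa [Ω, Nat.descFactorial_self] using h

lemma get_eq {m : ℕ} (x : Fin (m + 1) → Fin (m + 1)) {i : ℕ} (hi : i - 1 < m + 1) :
    get x i = x ⟨i - 1, hi⟩ := by
  simp [get, Nat.mod_eq_of_lt hi]

lemma get_comp_swap {m : ℕ} (x : Fin (m + 1) → Fin (m + 1)) {p a : Fin (m + 1)} {i j : ℕ}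
    (hi : i ≤ m + 1) (hji : j < i) (hp : (p : ℕ) < j) (ha : (a : ℕ) < j) :
    get (x ∘ Equiv.swap p a) i = get x i := by
  rw [get_eq _ (by omega), get_eq _ (by omega), Function.comp_apply,
    Equiv.swap_apply_of_ne_of_ne]
  all_goals
    rw [ne_eq, Fin.ext_iff]
    simp only
    omega

lemma pre_comp_swap {n : ℕ} (x : Fin n → Fin n) {p a : Fin n} {i : ℕ}
    (hp : (p : ℕ) < i) (ha : (a : ℕ) < i) :
    pre (x ∘ Equiv.swap p a) i = pre x i := by
  have h : (univ.filter fun j : Fin n => (j : ℕ) < i).image (Equiv.swap p a) =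
      univ.filter fun j : Fin n => (j : ℕ) < i := by
    apply eq_of_subset_of_card_le
    · intro j
      simp only [mem_image, mem_filter, mem_univ, true_and]
      rintro ⟨b, hb, rfl⟩
      rw [Equiv.swap_apply_def]
      split_ifs <;> assumption
    · rw [card_image_of_injective _ (Equiv.injective _)]
  rw [pre, ← image_image, h, pre]

lemma card_positions_lt {n i : ℕ} (hi : i ≤ n) :
    #(univ.filter fun j : Fin n => (j : ℕ) < i) = i := by
  rw [Fin.card_filter_val_lt, min_eq_right hi]

lemma card_pre {n : ℕ} {x : Fin n → Fin n} (hx : x ∈ Ω n) {i : ℕ} (hi : i ≤ n) :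
    #(pre x i) = i := by
  simp only [Ω, mem_filter, mem_univ, true_and] at hx
  rw [pre, card_image_of_injective _ hx, card_positions_lt hi]

lemma card_filter_positions {n : ℕ} {x : Fin n → Fin n} (hx : x ∈ Ω n) (s : Finset (Fin n))
    {q : Fin n} (R : Fin n → Prop) [DecidablePred R] :
    #((s.erase q).filter fun a => R (x a)) = #(((s.image x).erase (x q)).filter R) := by
  simp only [Ω, mem_filter, mem_univ, true_and] at hx
  rw [← image_erase hx, filter_image, card_image_of_injective _ hx]

lemma get_mem_pre {m : ℕ} (x : Fin (m + 1) → Fin (m + 1)) {i j : ℕ} (hi : 1 ≤ i)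
    (him : i ≤ m + 1) (hij : i ≤ j) : get x i ∈ pre x j := by
  rw [get_eq _ (by omega)]
  exact mem_image_of_mem _ (by simp; omega)

lemma Lam_mem_Ω {m j k : ℕ} {x : Fin (m + 1) → Fin (m + 1)} (hx : x ∈ Lam (m + 1) j k) :
    x ∈ Ω (m + 1) := (mem_filter.mp hx).1

lemma Lam_eq_filter {m j k : ℕ} (hjk : j ≤ k) :
    Lam (m + 1) j k =
      (Lam (m + 1) (j + 1) k).filter fun x => ¬ Adj (pre x j) (get x (j - 1)) (get x j) := by
  ext x
  simp only [Lam, mem_filter, and_assoc]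
  refine and_congr_right fun _ => and_congr_right fun _ => ⟨fun h => ?_, fun h i hi hij => ?_⟩
  · exact ⟨fun i hi hij => h i hi (by omega), h j hjk le_rfl⟩
  · rcases hij.eq_or_lt with rfl | hlt
    · exact h.2
    · exact h.1 i hi hlt

lemma comp_swap_mem_Lam {m j k : ℕ} (hjk : j ≤ k) (hkm : k ≤ m)
    {x : Fin (m + 1) → Fin (m + 1)} (hx : x ∈ Lam (m + 1) (j + 1) k) {p a : Fin (m + 1)}
    (hp : (p : ℕ) < j - 1) (ha : (a : ℕ) < j - 1) :
    x ∘ Equiv.swap p a ∈ Lam (m + 1) (j + 1) k := by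
  simp only [Lam, mem_filter] at hx ⊢
  obtain ⟨hΩ, hadj, hnot⟩ := hx
  refine ⟨comp_swap_mem_Ω hΩ p a, ?_, fun i hi hji => ?_⟩
  · rwa [get_comp_swap x (j := j - 1) (by omega) (by omega) hp ha,
      get_comp_swap x (j := j - 1) (by omega) (by omega) hp ha]
  · rw [get_comp_swap x (j := j - 1) (by omega) (by omega) hp ha,
      get_comp_swap x (j := j - 1) (by omega) (by omega) hp ha,
      pre_comp_swap x (by omega) (by omega)]
    exact hnot i hi hji

lemma card_Lam_step {m j k : ℕ} (hj : 3 ≤ j) (hjk : j ≤ k) (hkm : k ≤ m) :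
    #(Lam (m + 1) j k) * (j - 1) = #(Lam (m + 1) (j + 1) k) * (j - 3) := by
  have hpos : (univ.filter fun a : Fin (m + 1) => (a : ℕ) < j - 1) =
      (univ.filter fun a : Fin (m + 1) => (a : ℕ) < j).erase ⟨j - 1, by omega⟩ := by
    ext a
    simp only [mem_filter, mem_univ, true_and, mem_erase, ne_eq, Fin.ext_iff]
    omega
  have h := card_filter_mul_card_of_swap (S := Lam (m + 1) (j + 1) k)
    (p := ⟨j - 1 - 1, by omega⟩) (J := univ.filter fun a : Fin (m + 1) => (a : ℕ) < j - 1)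
    (R := fun x v => ¬ Adj (pre x j) v (get x j)) (c := j - 3) ?_ ?_ ?_
  · rw [card_positions_lt (by omega)] at h
    rw [← h, Lam_eq_filter hjk]
    simp only [get_eq _ (show j - 1 - 1 < m + 1 by omega)]
  · intro x hx a ha
    exact comp_swap_mem_Lam hjk hkm hx (by simp; omega) (by simpa using ha)
  · intro x _ a ha v
    have ha' : (a : ℕ) < j - 1 := by simpa using ha
    rw [get_comp_swap x (j := j - 1) (by omega) (by omega) (by simp; omega) ha',
      pre_comp_swap x (by simp; omega) (by omega)]
  · intro x hx
    have hΩ := Lam_mem_Ω hx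
    have hcard : #(pre x j) = j := card_pre hΩ (by omega)
    have hmem := get_mem_pre x (show 1 ≤ j by omega) (show j ≤ m + 1 by omega) le_rfl
    rw [hpos, card_filter_positions hΩ _ fun v => ¬ Adj (pre x j) v (get x j),
      ← get_eq x]
    exact (card_erase_not_adj (by omega) hmem).trans (by rw [hcard])

lemma card_Lam_base {m k : ℕ} (hm : 2 ≤ m) (hk : 1 ≤ k) (hkm : k ≤ m) :
    #(Lam (m + 1) (k + 1) k) * m = 2 * (m + 1).factorial := by
  have hLam : Lam (m + 1) (k + 1) k =
      (Ω (m + 1)).filter fun x => Adj univ (get x k) (get x (k + 1)) := by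
    ext x
    simp only [Lam, mem_filter]
    refine and_congr_right fun _ => and_iff_left fun i hi hki => by omega
  have h := card_filter_mul_card_of_swap (S := Ω (m + 1)) (p := ⟨k - 1, by omega⟩)
    (J := univ.erase (⟨k, by omega⟩ : Fin (m + 1)))
    (R := fun x v => Adj univ v (get x (k + 1))) (c := 2) ?_ ?_ ?_
  · rw [card_Ω, card_erase_of_mem (mem_univ _), card_univ, Fintype.card_fin,
      Nat.add_sub_cancel] at h
    rw [mul_comm 2, ← h, hLam]
    simp only [get_eq _ (show k - 1 < m + 1 by omega)]
  · exact fun x hx a _ => comp_swap_mem_Ω hx _ a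
  · intro x _ a ha v
    rw [get_eq _ (by omega), get_eq _ (by omega), Function.comp_apply,
      Equiv.swap_apply_of_ne_of_ne]
    · simp only [ne_eq, Fin.ext_iff]
      omega
    · simpa using (ne_of_mem_erase ha).symm
  · intro x hx
    have hinj : Function.Injective x := (mem_filter.mp hx).2
    rw [card_filter_positions hx _ fun v => Adj univ v (get x (k + 1)),
      image_univ_of_surjective (Finite.injective_iff_surjective.mp hinj)]
    have hget : get x (k + 1) = x ⟨k, by omega⟩ := get_eq _ (by omega)
    rw [hget]
    exact card_erase_adj (by simp; omega) (mem_univ _)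

lemma card_Lam {m r k : ℕ} (hr : 3 ≤ r) (hrk : r ≤ k + 1) (hkm : k ≤ m) :
    (#(Lam (m + 1) r k) : ℚ) * (m * ((k - 1) * (k - 2))) =
      2 * (m + 1).factorial * ((r - 2) * (r - 3)) := by
  induction hrk using Nat.decreasingInduction with
  | self =>
    have h : (#(Lam (m + 1) (k + 1) k) : ℚ) * m = 2 * (m + 1).factorial := by
      exact_mod_cast card_Lam_base (by omega) (by omega) hkm
    push_cast
    linear_combination ((k : ℚ) - 1) * (k - 2) * h
  | of_succ j hj ih =>
    have h : (#(Lam (m + 1) j k) : ℚ) * (j - 1) = #(Lam (m + 1) (j + 1) k) * (j - 3) := by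
      have := congrArg (Nat.cast (R := ℚ)) (card_Lam_step hr (by omega) hkm)
      rw [Nat.cast_mul, Nat.cast_mul, Nat.cast_sub (by omega), Nat.cast_sub hr] at this
      exact_mod_cast this
    have ih := ih (by omega)
    push_cast at ih
    have hj1 : (j : ℚ) - 1 ≠ 0 := by
      have : (3 : ℚ) ≤ j := by exact_mod_cast hr
      linarith
    apply mul_left_cancel₀ hj1
    linear_combination (m : ℚ) * ((k - 1) * (k - 2)) * h + ((j : ℚ) - 3) * ih

lemma rr_univ {n : ℕ} (x : Fin n) : rr univ x = x + 1 := by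
  rw [rr, filter_ge_eq_Iic, Fin.card_Iic]
  norm_cast

lemma Adj.symm {n : ℕ} {P : Finset (Fin n)} {x y : Fin n} (h : Adj P x y) : Adj P y x :=
  ⟨h.2.1, h.1, h.2.2.symm⟩

/-- Applicants that are neighbours among all applicants remain so in every subset. -/
lemma Adj.of_univ {n : ℕ} {P : Finset (Fin n)} {x y : Fin n} (hx : x ∈ P)
    (hy : y ∈ P) (hxy : x ≠ y) (h : Adj univ x y) : Adj P x y := by
  wlog hlt : x < y generalizing x y
  · exact (this hy hx hxy.symm h.symm (lt_of_le_of_ne (not_lt.mp hlt) hxy.symm)).symm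
  refine ⟨hx, hy, Or.inr ?_⟩
  obtain ⟨-, -, h⟩ := h
  simp only [rr_univ, mem_Δ, card_univ, Fintype.card_fin] at h
  have hlt' : (x : ℕ) < y := hlt
  have hyn := y.isLt
  rw [mem_Δ]
  have hcases : (y : ℕ) = x + 1 ∨ (x : ℕ) = 0 ∧ (y : ℕ) + 1 = n := by omega
  rcases hcases with hsucc | ⟨hzero, hlast⟩
  · have hins : (P.filter fun z => z ≤ y) = insert y (P.filter fun z => z ≤ x) := by
      ext z
      simp only [mem_filter, mem_insert, Fin.le_def, Fin.ext_iff]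
      constructor
      · rintro ⟨hz, hzy⟩
        by_cases hzx : (z : ℕ) ≤ x
        · exact Or.inr ⟨hz, hzx⟩
        · exact Or.inl (by omega)
      · rintro (hz | ⟨hz, hzx⟩)
        · exact ⟨Fin.ext hz ▸ hy, hz.le⟩
        · exact ⟨hz, by omega⟩
    right; left
    rw [rr, rr, hins, card_insert_of_notMem (by simp [hlt])]
    push_cast
    ring
  · have h1 : (P.filter fun z => z ≤ x) = {x} := by
      ext z
      simp only [mem_filter, mem_singleton, Fin.le_def, Fin.ext_iff]
      constructor
      · rintro ⟨-, hz⟩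
        omega
      · intro hz
        exact ⟨Fin.ext hz ▸ hx, hz.le⟩
    have h2 : (P.filter fun z => z ≤ y) = P :=
      filter_true_of_mem fun z _ => by rw [Fin.le_def]; omega
    right; right; left
    rw [rr, rr, h1, h2, card_singleton]
    rfl

lemma sum_inv_consecutive {r m : ℕ} (hr : 3 ≤ r) (hrm : r ≤ m + 1) :
    ∑ k ∈ Icc r m, (1 : ℚ) / ((k - 1) * (k - 2)) = 1 / (r - 2) - 1 / (m - 1) := by
  induction m with
  | zero => omega
  | succ m ih =>
    have hr' : (3 : ℚ) ≤ r := by exact_mod_cast hr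
    rcases hrm.eq_or_lt with rfl | hlt
    · rw [Icc_eq_empty (by omega), sum_empty]
      push_cast
      ring
    · have hm : (r : ℚ) ≤ m + 1 := by exact_mod_cast Nat.lt_succ_iff.mp hlt
      rw [sum_Icc_succ_top (by omega), ih (by omega)]
      have h1 : (m : ℚ) - 1 ≠ 0 := by linarith
      have h2 : (m : ℚ) ≠ 0 := by linarith
      have h3 : (r : ℚ) - 2 ≠ 0 := by linarith
      have h4 : (m : ℚ) + 1 - 2 ≠ 0 := by linarith
      push_cast
      rw [add_sub_cancel_right, show (m : ℚ) + 1 - 2 = m - 1 by ring]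
      field_simp
      ring

lemma pairwiseDisjoint_Lam {m r : ℕ} (hr : 2 ≤ r) :
    (Icc r m : Set ℕ).PairwiseDisjoint (Lam (m + 1) r) := by
  have key : ∀ k ∈ Set.Icc r m, ∀ l ∈ Set.Icc r m, k < l →
      Disjoint (Lam (m + 1) r k) (Lam (m + 1) r l) := by
    intro k hk l hl hkl
    rw [disjoint_left]
    intro x hxk hxl
    have hΩ := Lam_mem_Ω hxk
    simp only [Lam, mem_filter] at hxk hxl
    obtain ⟨hk1, hk2⟩ := hk
    obtain ⟨hl1, hl2⟩ := hl
    refine hxl.2.2 (k + 1) (by omega) (by omega) (Adj.of_univ ?_ ?_ ?_ hxk.2.1)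
    · exact get_mem_pre x (by omega) (by omega) (by omega)
    · exact get_mem_pre x (by omega) (by omega) (by omega)
    · rw [get_eq _ (show k + 1 - 1 - 1 < m + 1 by omega), get_eq _ (by omega)]
      intro h
      have := (mem_filter.mp hΩ).2 h
      simp only [Fin.ext_iff] at this
      omega
  intro k hk l hl hkl
  rcases Nat.lt_or_gt_of_ne hkl with h | h
  · exact key k (by simpa using hk) l (by simpa using hl) h
  · exact (key l (by simpa using hl) k (by simpa using hk) h).symm

/-- if `r ∈ {3,…,n-1}`, then
`|Λ_n(r)| / |Ω_n| = 2(r-3)/(n-1) − 2(r-2)(r-3)/((n-1)(n-2))` in `ℚ`. -/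
theorem statement7 {n : ℕ} (hn : 3 < n) (r : ℕ) (hr1 : 3 ≤ r) (hr2 : r ≤ n - 1) :
    ((LamU n r).card : ℚ) / (Nat.factorial n : ℚ) =
      2 * ((r : ℚ) - 3) / ((n : ℚ) - 1) -
        2 * (((r : ℚ) - 2) * ((r : ℚ) - 3)) / (((n : ℚ) - 1) * ((n : ℚ) - 2)) := by
  obtain ⟨m, rfl⟩ : ∃ m, n = m + 1 := ⟨n - 1, by omega⟩
  rw [Nat.add_sub_cancel] at hr2
  have hr3 : (3 : ℚ) ≤ r := by exact_mod_cast hr1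
  have hrm : (r : ℚ) ≤ m := by exact_mod_cast hr2
  have hm : (m : ℚ) ≠ 0 := by linarith
  have hm1 : (m : ℚ) - 1 ≠ 0 := by linarith
  have hr : (r : ℚ) - 2 ≠ 0 := by linarith
  have hfact : ((m + 1).factorial : ℚ) ≠ 0 := by exact_mod_cast Nat.factorial_ne_zero _
  have hterm : ∀ k ∈ Icc r m, (#(Lam (m + 1) r k) : ℚ) =
      2 * (m + 1).factorial * ((r - 2) * (r - 3)) / m * (1 / ((k - 1) * (k - 2))) := by
    intro k hk
    rw [mem_Icc] at hk
    have hk3 : (3 : ℚ) ≤ k := by exact_mod_cast hr1.trans hk.1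
    have hk1 : (k : ℚ) - 1 ≠ 0 := by linarith
    have hk2 : (k : ℚ) - 2 ≠ 0 := by linarith
    have h := card_Lam hr1 (by omega) hk.2
    field_simp
    linear_combination h
  rw [LamU, Nat.add_sub_cancel, card_biUnion (pairwiseDisjoint_Lam (by omega)), Nat.cast_sum,
    sum_congr rfl hterm, ← mul_sum, sum_inv_consecutive hr1 (by omega)]
  push_cast
  rw [add_sub_cancel_right, show (m : ℚ) + 1 - 2 = m - 1 by ring]
  field_simp
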